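/- Let (X,d) be a metric space and μ a Borel measure on X with 0 < μ(B(x,r)) < ∞ for every x ∈ X and r > 0, and suppose that μ(B(x,R)) ≤ (R/r)^N · μ(B(x,r)) for all x ∈ X and 0 < r < R, for some N > 0. Then for every x ∈ X and every t > 0 it holds ∫_X exp(−d(x,y)²/(5t)) dμ(y) ≤ μ(B(x,√t)) · ∫_0^∞ (1/5)·e^{−s/5}·max(s,1)^{N/2} ds; in particular sup_{t>0} μ(B(x,√t))⁻¹ ∫_X exp(−d(x,y)²/(5t)) dμ(y) is finite. -/

import Mathlib

open MeasureTheory Metric Set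
open scoped ENNReal

/-- A measure on a metric space that is finite on the balls around a point is σ-finite. -/
theorem sigmaFinite_of_measure_ball_lt_top {X : Type*} [MetricSpace X] [MeasurableSpace X]
    (μ : Measure X) (x : X) (hfin : ∀ r : ℝ, 0 < r → μ (ball x r) < ⊤) :
    SigmaFinite μ := by
  refine ⟨⟨⟨fun n : ℕ => ball x (n + 1), fun _ => trivial, fun n => hfin _ (by positivity), ?_⟩⟩⟩
  refine eq_univ_of_forall fun y => mem_iUnion.2 ?_
  obtain ⟨n, hn⟩ := exists_nat_gt (dist y x)
  exact ⟨n, mem_ball.2 (by linarith)⟩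

theorem ofReal_exp_eq_lintegral_Ioi (a : ℝ) :
    ENNReal.ofReal (Real.exp (-a / 5)) =
      ∫⁻ s in Ioi a, ENNReal.ofReal ((1 / 5) * Real.exp (-s / 5)) := by
  have hrw : (fun s : ℝ => (1 / 5) * Real.exp (-s / 5)) =
      fun s => (1 / 5) * Real.exp ((-1 / 5) * s) := by
    funext s
    ring_nf
  have hint : IntegrableOn (fun s : ℝ => (1 / 5) * Real.exp (-s / 5)) (Ioi a) := by
    rw [hrw]
    exact (integrableOn_exp_mul_Ioi (by norm_num) a).const_mul _
  rw [← ofReal_integral_eq_lintegral_ofReal hint (ae_of_all _ fun s => by positivity), hrw,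
    integral_const_mul, integral_exp_mul_Ioi (by norm_num)]
  congr 1
  ring_nf

theorem integrableOn_exp_mul_max_rpow {p : ℝ} (hp : 0 < p) :
    IntegrableOn (fun s : ℝ => (1 / 5) * Real.exp (-s / 5) * max s 1 ^ p) (Ioi 0) := by
  have h1 : IntegrableOn (fun s : ℝ => s ^ p * Real.exp (-(1 / 5) * s)) (Ioi 0) := by
    simpa using integrableOn_rpow_mul_exp_neg_mul_rpow (p := 1) (s := p) (b := 1 / 5)
      (by linarith) one_pos (by norm_num)
  have h2 : IntegrableOn (fun s : ℝ => Real.exp (-(1 / 5) * s)) (Ioi 0) :=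
    integrableOn_exp_mul_Ioi (by norm_num) 0
  refine Integrable.mono' (h1.add h2) (by fun_prop) ?_
  refine (ae_restrict_iff' measurableSet_Ioi).2 (ae_of_all _ fun s hs => ?_)
  have hs : 0 < s := hs
  rw [Real.norm_of_nonneg (by positivity)]
  have he : Real.exp (-s / 5) = Real.exp (-(1 / 5) * s) := by ring_nf
  have hm : max s 1 ^ p ≤ s ^ p + 1 := by
    have : 0 ≤ s ^ p := by positivity
    rcases max_cases s 1 with h | h <;> rw [h.1]
    · linarith
    · simpa using this
  simp only [Pi.add_apply]
  rw [he]
  have hE := Real.exp_pos (-(1 / 5) * s)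
  have hM : 0 ≤ max s 1 ^ p := by positivity
  nlinarith [mul_le_mul_of_nonneg_left hm hE.le, mul_nonneg hE.le hM]

theorem lintegral_exp_neg_sq_dist_eq {X : Type*} [MetricSpace X] [MeasurableSpace X]
    [BorelSpace X] (μ : Measure X) [SFinite μ] (x : X) {t : ℝ} (ht : 0 < t) :
    ∫⁻ y, ENNReal.ofReal (Real.exp (-(dist x y ^ 2) / (5 * t))) ∂μ =
      ∫⁻ s in Ioi (0 : ℝ), ENNReal.ofReal ((1 / 5) * Real.exp (-s / 5)) *
        μ (ball x (Real.sqrt (t * s))) := by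
  set g : ℝ → ℝ≥0∞ := fun s => ENNReal.ofReal ((1 / 5) * Real.exp (-s / 5)) with hg
  have hgm : Measurable g := by fun_prop
  have hS : MeasurableSet {p : X × ℝ | dist x p.1 ^ 2 / t < p.2} :=
    measurableSet_lt (by fun_prop) (by fun_prop)
  calc _ = ∫⁻ y, (∫⁻ s in Ioi (0 : ℝ),
        {p : X × ℝ | dist x p.1 ^ 2 / t < p.2}.indicator (fun p => g p.2) (y, s)) ∂μ := by
        refine lintegral_congr fun y => ?_
        have h0 : 0 ≤ dist x y ^ 2 / t := by positivity
        have hy : -(dist x y ^ 2) / (5 * t) = -(dist x y ^ 2 / t) / 5 := by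
          field_simp
        rw [hy, ofReal_exp_eq_lintegral_Ioi]
        change _ = ∫⁻ s in Ioi (0 : ℝ), (Ioi (dist x y ^ 2 / t)).indicator g s
        rw [lintegral_indicator measurableSet_Ioi, Measure.restrict_restrict measurableSet_Ioi,
          inter_eq_left.2 (Ioi_subset_Ioi h0)]
    _ = ∫⁻ s in Ioi (0 : ℝ), ∫⁻ y,
        {p : X × ℝ | dist x p.1 ^ 2 / t < p.2}.indicator (fun p => g p.2) (y, s) ∂μ :=
        lintegral_lintegral_swap
          ((hgm.comp measurable_snd).indicator hS).aemeasurable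
    _ = _ := by
        refine lintegral_congr fun s => ?_
        have hb : ∀ y, {p : X × ℝ | dist x p.1 ^ 2 / t < p.2}.indicator (fun p => g p.2) (y, s) =
            (ball x (Real.sqrt (t * s))).indicator (fun _ => g s) y := by
          intro y
          have : (y, s) ∈ {p : X × ℝ | dist x p.1 ^ 2 / t < p.2} ↔ y ∈ ball x (Real.sqrt (t * s)) := by
            rw [mem_ofPred_eq, mem_ball', Real.lt_sqrt dist_nonneg, div_lt_iff₀' ht]
          classical
          rw [indicator_apply, indicator_apply]
          exact if_congr this rfl rfl
        simp_rw [hb]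
        rw [lintegral_indicator measurableSet_ball, setLIntegral_const]

theorem measure_ball_sqrt_mul_le {X : Type*} [MetricSpace X] [MeasurableSpace X]
    (μ : Measure X) (N : ℝ) (x : X)
    (hBG : ∀ r R : ℝ, 0 < r → r < R →
      μ (ball x R) ≤ ENNReal.ofReal ((R / r) ^ N) * μ (ball x r))
    {t : ℝ} (ht : 0 < t) (s : ℝ) :
    μ (ball x (Real.sqrt (t * s))) ≤
      ENNReal.ofReal (max s 1 ^ (N / 2)) * μ (ball x (Real.sqrt t)) := by
  rcases le_or_gt s 1 with hs | hs
  · rw [max_eq_right hs, Real.one_rpow, ENNReal.ofReal_one, one_mul]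
    exact measure_mono (ball_subset_ball (Real.sqrt_le_sqrt (by nlinarith)))
  · have h := hBG (Real.sqrt t) (Real.sqrt (t * s)) (Real.sqrt_pos.2 ht)
      (Real.sqrt_lt_sqrt ht.le (by nlinarith))
    rw [max_eq_left hs.le]
    convert h using 3
    rw [Real.sqrt_mul ht.le, mul_div_cancel_left₀ _ (Real.sqrt_pos.2 ht).ne', Real.sqrt_eq_rpow,
      ← Real.rpow_mul (by linarith)]
    ring_nf

/-- Under the Bishop–Gromov-type bound `μ(B(x,R)) ≤ (R/r)^N μ(B(x,r))`, for every `x` and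
`t > 0`,
`∫_X e^{−d(x,y)²/(5t)} dμ(y) ≤ μ(B(x,√t)) ∫_0^∞ (1/5) e^{−s/5} max(s,1)^{N/2} ds`;
in particular `sup_{t>0} μ(B(x,√t))⁻¹ ∫_X e^{−d(x,y)²/(5t)} dμ(y)` is finite. -/
theorem stmt_14 {X : Type*} [MetricSpace X] [MeasurableSpace X] [BorelSpace X]
    (μ : Measure X) (N : ℝ) (hN : 0 < N)
    (hpos : ∀ (x : X) (r : ℝ), 0 < r → 0 < μ (ball x r))
    (hfin : ∀ (x : X) (r : ℝ), 0 < r → μ (ball x r) < ⊤)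
    (hBG : ∀ (x : X) (r R : ℝ), 0 < r → r < R →
      μ (ball x R) ≤ ENNReal.ofReal ((R / r) ^ N) * μ (ball x r)) :
    (∀ (x : X) (t : ℝ), 0 < t →
      (∫⁻ y, ENNReal.ofReal (Real.exp (-(dist x y ^ 2) / (5 * t))) ∂μ) ≤
        μ (ball x (Real.sqrt t)) *
          ENNReal.ofReal (∫ s in Set.Ioi (0 : ℝ),
            (1 / 5) * Real.exp (-s / 5) * max s 1 ^ (N / 2))) ∧
    ∀ x : X,
      (⨆ t ∈ Set.Ioi (0 : ℝ),
        (μ (ball x (Real.sqrt t)))⁻¹ *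
          ∫⁻ y, ENNReal.ofReal (Real.exp (-(dist x y ^ 2) / (5 * t))) ∂μ) < ⊤ := by
  have main : ∀ (x : X) (t : ℝ), 0 < t →
      (∫⁻ y, ENNReal.ofReal (Real.exp (-(dist x y ^ 2) / (5 * t))) ∂μ) ≤
        μ (ball x (Real.sqrt t)) *
          ENNReal.ofReal (∫ s in Set.Ioi (0 : ℝ),
            (1 / 5) * Real.exp (-s / 5) * max s 1 ^ (N / 2)) := by
    intro x t ht
    have := sigmaFinite_of_measure_ball_lt_top μ x (hfin x)
    rw [lintegral_exp_neg_sq_dist_eq μ x ht,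
      ofReal_integral_eq_lintegral_ofReal (integrableOn_exp_mul_max_rpow (half_pos hN))
        (ae_of_all _ fun s => by positivity),
      ← lintegral_const_mul _ (by fun_prop)]
    refine lintegral_mono fun s => ?_
    dsimp only
    rw [ENNReal.ofReal_mul (by positivity : (0 : ℝ) ≤ 1 / 5 * Real.exp (-s / 5)), mul_left_comm]
    gcongr
    exact (measure_ball_sqrt_mul_le μ N x (hBG x) ht s).trans_eq (mul_comm _ _)
  refine ⟨main, fun x => ?_⟩
  refine lt_of_le_of_lt (iSup₂_le fun t ht => ?_) (ENNReal.ofReal_lt_top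
    (r := ∫ s in Set.Ioi (0 : ℝ), (1 / 5) * Real.exp (-s / 5) * max s 1 ^ (N / 2)))
  rw [← ENNReal.div_eq_inv_mul]
  exact ENNReal.div_le_of_le_mul' (main x t ht)
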